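/- Let d ≥ 1, s > d/2, n ≥ 1 and M > 0. Then there exists a constant C depending only on d, s, n and M such that for all v, w ∈ h^s with |v|_s ≤ M and |w|_s ≤ M one has |P(v, n) − P(w, n)|_s ≤ C |v − w|_s, where P(v, n) = (P_k(v, n))_{k∈ℤ^d}. -/

import Mathlib

open scoped BigOperators

/-- `lam d k = |k|²`, the squared Euclidean norm of `k ∈ ℤ^d`. -/
def lam (d : ℕ) (k : Fin d → ℤ) : ℤ := ∑ i, (k i) ^ 2

/-- The weight `|k|^{2s} + 1 = (|k|²)^s + 1` in the definition of the `h^s` norm. -/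
noncomputable def wt (d : ℕ) (s : ℝ) (k : Fin d → ℤ) : ℝ := ((lam d k : ℝ)) ^ s + 1

/-- `v ∈ h^s`, i.e. the series defining `|v|_s²` converges. -/
def memH (d : ℕ) (s : ℝ) (v : (Fin d → ℤ) → ℂ) : Prop :=
  Summable fun k => wt d s k * ‖v k‖ ^ 2

/-- The norm `|v|_s` of `h^s`. -/
noncomputable def hnorm (d : ℕ) (s : ℝ) (v : (Fin d → ℤ) → ℂ) : ℝ :=
  Real.sqrt (∑' k, wt d s k * ‖v k‖ ^ 2)

/-- The summand of `P_k(v,n)`: the monomial `v_{k₁} conj(v_{k₂}) ⋯ v_{k_{2n+1}}` if the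
tuple `κ` lies in `S(k,n)` (i.e. the alternating sum of `κ` equals `k`), and `0` otherwise. -/
noncomputable def Pterm (d n : ℕ) (v : (Fin d → ℤ) → ℂ) (k : Fin d → ℤ)
    (κ : Fin (2 * n + 1) → (Fin d → ℤ)) : ℂ :=
  if (∑ j : Fin (2 * n + 1), ((-1 : ℤ) ^ (j : ℕ)) • κ j) = k then
    ∏ j : Fin (2 * n + 1), (if Even (j : ℕ) then v (κ j) else (starRingEnd ℂ) (v (κ j)))
  else 0

/-- `P_k(v,n) = Σ_{(k₁,…,k_{2n+1}) ∈ S(k,n)} v_{k₁} conj(v_{k₂}) ⋯ v_{k_{2n+1}}`. -/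
noncomputable def Pk (d n : ℕ) (v : (Fin d → ℤ) → ℂ) (k : Fin d → ℤ) : ℂ :=
  ∑' κ : Fin (2 * n + 1) → (Fin d → ℤ), Pterm d n v k κ

/-- The summand of `R_k(v,n)`: as `Pterm`, but restricted to resonant tuples. -/
noncomputable def Rterm (d n : ℕ) (v : (Fin d → ℤ) → ℂ) (k : Fin d → ℤ)
    (κ : Fin (2 * n + 1) → (Fin d → ℤ)) : ℂ :=
  if (∑ j : Fin (2 * n + 1), ((-1 : ℤ) ^ (j : ℕ)) • κ j) = k ∧
      (∑ j : Fin (2 * n + 1), ((-1 : ℤ) ^ (j : ℕ)) * lam d (κ j)) = lam d k then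
    ∏ j : Fin (2 * n + 1), (if Even (j : ℕ) then v (κ j) else (starRingEnd ℂ) (v (κ j)))
  else 0

/-- `R_k(v,n)`, the resonant part of `P_k(v,n)`. -/
noncomputable def Rk (d n : ℕ) (v : (Fin d → ℤ) → ℂ) (k : Fin d → ℤ) : ℂ :=
  ∑' κ : Fin (2 * n + 1) → (Fin d → ℤ), Rterm d n v k κ

open scoped ENNReal

/-- Cauchy–Schwarz inequality for series in `ℝ≥0∞`. -/
lemma ENNReal.sq_tsum_le_of_sq_le {ι : Type*} {x u v : ι → ℝ≥0∞} (h : ∀ i, x i ^ 2 ≤ u i * v i) :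
    (∑' i, x i) ^ 2 ≤ (∑' i, u i) * ∑' i, v i := by
  let _ : MeasurableSpace ι := ⊤
  have hsq : ∀ a : ℝ≥0∞, (a ^ (2⁻¹ : ℝ)) ^ (2 : ℝ) = a := fun a => by
    rw [← ENNReal.rpow_mul]; norm_num
  have hx : ∀ i, x i ≤ u i ^ (2⁻¹ : ℝ) * v i ^ (2⁻¹ : ℝ) := fun i => by
    rw [← ENNReal.mul_rpow_of_nonneg _ _ (by norm_num), ENNReal.le_rpow_inv_iff (by norm_num)]
    exact_mod_cast h i
  have hcs := ENNReal.lintegral_mul_le_Lp_mul_Lq (MeasureTheory.Measure.count (α := ι))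
    Real.HolderConjugate.two_two (f := fun i => u i ^ (2⁻¹ : ℝ))
    (g := fun i => v i ^ (2⁻¹ : ℝ)) measurable_from_top.aemeasurable
    measurable_from_top.aemeasurable
  simp only [MeasureTheory.lintegral_count, hsq, Pi.mul_apply] at hcs
  rw [← ENNReal.mul_rpow_of_nonneg _ _ (by norm_num), one_div,
    ENNReal.le_rpow_inv_iff (by norm_num)] at hcs
  refine le_trans ?_ hcs
  rw [ENNReal.rpow_two]
  gcongr with i
  exact hx i

lemma ENNReal.sq_sum_le {ι : Type*} [Fintype ι] (f : ι → ℝ≥0∞) :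
    (∑ i, f i) ^ 2 ≤ Fintype.card ι * ∑ i, f i ^ 2 := by
  simpa [tsum_fintype] using
    ENNReal.sq_tsum_le_of_sq_le (x := f) (u := fun _ => 1) (v := fun i => f i ^ 2) (by simp)

/-- The `h^s` weight as an extended nonnegative real. -/
noncomputable def ewt (d : ℕ) (s : ℝ) (k : Fin d → ℤ) : ℝ≥0∞ := ENNReal.ofReal (wt d s k)

/-- The squared `h^s` norm of a sequence in `ℝ≥0∞`. -/
noncomputable def energy (d : ℕ) (s : ℝ) (f : (Fin d → ℤ) → ℝ≥0∞) : ℝ≥0∞ :=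
  ∑' k, ewt d s k * f k ^ 2

/-- The multilinear form underlying `Pk`, for sequences in `ℝ≥0∞`. -/
noncomputable def altConv (d m : ℕ) (F : Fin m → (Fin d → ℤ) → ℝ≥0∞) (k : Fin d → ℤ) : ℝ≥0∞ :=
  ∑' κ : Fin m → (Fin d → ℤ),
    if (∑ j : Fin m, ((-1 : ℤ) ^ (j : ℕ)) • κ j) = k then ∏ j, F j (κ j) else 0

lemma lam_nonneg (d : ℕ) (k : Fin d → ℤ) : 0 ≤ lam d k := Finset.sum_nonneg fun _ _ => sq_nonneg _

lemma one_le_wt (d : ℕ) (s : ℝ) (k : Fin d → ℤ) : 1 ≤ wt d s k := by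
  have : (0 : ℝ) ≤ lam d k := mod_cast lam_nonneg d k
  have := Real.rpow_nonneg this s
  unfold wt; linarith

lemma one_le_ewt (d : ℕ) (s : ℝ) (k : Fin d → ℤ) : 1 ≤ ewt d s k := by
  simpa [ewt] using one_le_wt d s k

lemma ewt_ne_zero (d : ℕ) (s : ℝ) (k : Fin d → ℤ) : ewt d s k ≠ 0 :=
  (zero_lt_one.trans_le (one_le_ewt d s k)).ne'

lemma ewt_ne_top (d : ℕ) (s : ℝ) (k : Fin d → ℤ) : ewt d s k ≠ ⊤ := ENNReal.ofReal_ne_top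

lemma lam_sub_le (d : ℕ) (a b : Fin d → ℤ) : lam d (a - b) ≤ 2 * (lam d a + lam d b) := by
  simp only [lam, ← Finset.sum_add_distrib, Finset.mul_sum]
  refine Finset.sum_le_sum fun i _ => ?_
  simp only [Pi.sub_apply]
  nlinarith [sq_nonneg (a i + b i)]

lemma wt_sub_le (d : ℕ) {s : ℝ} (hs : 0 < s) (a b : Fin d → ℤ) :
    wt d s (a - b) ≤ 4 ^ s * (wt d s a + wt d s b) := by
  have ha : (0 : ℝ) ≤ lam d a := mod_cast lam_nonneg d a
  have hb : (0 : ℝ) ≤ lam d b := mod_cast lam_nonneg d b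
  have hab : (0 : ℝ) ≤ lam d (a - b) := mod_cast lam_nonneg d (a - b)
  have h : (lam d (a - b) : ℝ) ≤ 2 * (lam d a + lam d b) := mod_cast lam_sub_le d a b
  have h4 : (1 : ℝ) ≤ 4 ^ s := Real.one_le_rpow (by norm_num) hs.le
  have hmax : (max (lam d a : ℝ) (lam d b)) ^ s ≤ (lam d a : ℝ) ^ s + (lam d b : ℝ) ^ s := by
    have := Real.rpow_nonneg ha s
    have := Real.rpow_nonneg hb s
    rcases max_choice (lam d a : ℝ) (lam d b) with h | h <;> rw [h] <;> linarith
  have : (lam d (a - b) : ℝ) ^ s ≤ 4 ^ s * ((lam d a : ℝ) ^ s + (lam d b : ℝ) ^ s) := by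
    calc (lam d (a - b) : ℝ) ^ s ≤ (4 * max (lam d a : ℝ) (lam d b)) ^ s := by
          refine Real.rpow_le_rpow hab ?_ hs.le
          linarith [le_max_left (lam d a : ℝ) (lam d b), le_max_right (lam d a : ℝ) (lam d b)]
      _ = 4 ^ s * (max (lam d a : ℝ) (lam d b)) ^ s :=
          Real.mul_rpow (by norm_num) (ha.trans (le_max_left _ _))
      _ ≤ _ := by gcongr
  unfold wt
  nlinarith

lemma ewt_sub_le (d : ℕ) {s : ℝ} (hs : 0 < s) (a b : Fin d → ℤ) :
    ewt d s (a - b) ≤ ENNReal.ofReal (4 ^ s) * (ewt d s a + ewt d s b) := by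
  have ha := one_le_wt d s a
  have hb := one_le_wt d s b
  unfold ewt
  rw [← ENNReal.ofReal_add (by linarith) (by linarith), ← ENNReal.ofReal_mul (by positivity)]
  exact ENNReal.ofReal_le_ofReal (wt_sub_le d hs a b)

lemma summable_norm_intCast_rpow (d : ℕ) {r : ℝ} (hr : r < -d) :
    Summable fun k : Fin d → ℤ => ‖(fun i => (k i : ℝ))‖ ^ r := by
  let L := Submodule.span ℤ (Set.range (Pi.basisFun ℝ (Fin d)))
  have hmem : ∀ k : Fin d → ℤ, (fun i => (k i : ℝ)) ∈ L := fun k => by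
    rw [Module.Basis.mem_span_iff_repr_mem]
    simp
  have hrank : Module.finrank ℤ L = d := by
    rw [ZLattice.rank ℝ L]; simp
  have hsum := ZLattice.summable_norm_rpow L r (by rwa [hrank])
  refine hsum.comp_injective (i := fun k : Fin d → ℤ => (⟨_, hmem k⟩ : L)) fun a b hab => ?_
  funext i
  simpa using congrFun (congrArg Subtype.val hab) i

lemma norm_intCast_sq_le_lam (d : ℕ) (k : Fin d → ℤ) :
    ‖(fun i => (k i : ℝ))‖ ^ 2 ≤ (lam d k : ℝ) := by
  have h0 : (0 : ℝ) ≤ lam d k := mod_cast lam_nonneg d k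
  rw [← Real.le_sqrt (norm_nonneg _) h0, pi_norm_le_iff_of_nonneg (Real.sqrt_nonneg _)]
  intro i
  refine Real.le_sqrt_of_sq_le ?_
  rw [Real.norm_eq_abs, sq_abs]
  have : (k i) ^ 2 ≤ lam d k :=
    Finset.single_le_sum (f := fun i => (k i) ^ 2) (fun _ _ => sq_nonneg _) (Finset.mem_univ i)
  exact_mod_cast this

lemma summable_inv_wt (d : ℕ) {s : ℝ} (hs : (d : ℝ) / 2 < s) :
    Summable fun k : Fin d → ℤ => (wt d s k)⁻¹ := by
  have hs0 : 0 < s := lt_of_le_of_lt (by positivity) hs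
  refine Summable.of_nonneg_of_le (fun k => inv_nonneg.2 (zero_le_one.trans (one_le_wt d s k)))
    (fun k => ?_) ((summable_norm_intCast_rpow d (r := -(2 * s)) (by linarith)).add
      (hasSum_ite_eq (0 : Fin d → ℤ) (1 : ℝ)).summable)
  rcases eq_or_ne k 0 with rfl | hk
  · have := inv_le_one_of_one_le₀ (one_le_wt d s 0)
    have : 0 ≤ ‖(fun i => (((0 : Fin d → ℤ) i : ℤ) : ℝ))‖ ^ (-(2 * s)) := by positivity
    simp only [if_true]
    linarith
  · have hpos : 0 < ‖(fun i => (k i : ℝ))‖ := by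
      rw [norm_pos_iff]
      exact fun h => hk (funext fun i => by simpa using congrFun h i)
    rw [if_neg hk, add_zero, Real.rpow_neg hpos.le]
    refine inv_anti₀ (by positivity) ?_
    rw [Real.rpow_mul hpos.le, Real.rpow_two]
    have := Real.rpow_le_rpow (by positivity) (norm_intCast_sq_le_lam d k) hs0.le
    unfold wt; linarith

lemma tsum_inv_ewt_ne_top (d : ℕ) {s : ℝ} (hs : (d : ℝ) / 2 < s) :
    ∑' k, (ewt d s k)⁻¹ ≠ ⊤ := by
  have h : ∀ k, (ewt d s k)⁻¹ = ENNReal.ofReal (wt d s k)⁻¹ := fun k =>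
    (ENNReal.ofReal_inv_of_pos (zero_lt_one.trans_le (one_le_wt d s k))).symm
  simpa only [h] using (summable_inv_wt d hs).tsum_ofReal_ne_top

lemma ewt_sub_mul_inv_le (d : ℕ) {s : ℝ} (hs : 0 < s) (a b : Fin d → ℤ) :
    ewt d s (a - b) * (ewt d s a * ewt d s b)⁻¹ ≤
      ENNReal.ofReal (4 ^ s) * ((ewt d s a)⁻¹ + (ewt d s b)⁻¹) := by
  have ha := ewt_ne_zero d s a
  have hb := ewt_ne_zero d s b
  have ha' := ewt_ne_top d s a
  have hb' := ewt_ne_top d s b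
  refine (mul_le_mul_left (ewt_sub_le d hs a b) _).trans_eq ?_
  rw [ENNReal.mul_inv (.inl ha) (.inl ha'), mul_assoc, add_mul, ← mul_assoc,
    ENNReal.mul_inv_cancel ha ha', mul_left_comm, ENNReal.mul_inv_cancel hb hb', one_mul, mul_one,
    add_comm]

/-- The algebra property of `h^s`, with one factor reflected. -/
lemma energy_conv_le (d : ℕ) {s : ℝ} (hs : 0 < s) (f g : (Fin d → ℤ) → ℝ≥0∞) :
    energy d s (fun k => ∑' l, f l * g (l - k)) ≤
      (ENNReal.ofReal (4 ^ s) * (2 * ∑' k, (ewt d s k)⁻¹)) * (energy d s f * energy d s g) := by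
  set S := ∑' k, (ewt d s k)⁻¹
  have key : ∀ k, ewt d s k * (∑' l, f l * g (l - k)) ^ 2 ≤
      (ENNReal.ofReal (4 ^ s) * (2 * S)) *
        ∑' l, (ewt d s l * f l ^ 2) * (ewt d s (l - k) * g (l - k) ^ 2) := fun k => by
    have hcs := ENNReal.sq_tsum_le_of_sq_le (x := fun l => f l * g (l - k))
      (u := fun l => (ewt d s l * ewt d s (l - k))⁻¹)
      (v := fun l => (ewt d s l * f l ^ 2) * (ewt d s (l - k) * g (l - k) ^ 2)) fun l => by
        have h0 : ewt d s l * ewt d s (l - k) ≠ 0 :=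
          mul_ne_zero (ewt_ne_zero d s _) (ewt_ne_zero d s _)
        have ht : ewt d s l * ewt d s (l - k) ≠ ⊤ :=
          ENNReal.mul_ne_top (ewt_ne_top d s _) (ewt_ne_top d s _)
        rw [mul_mul_mul_comm, ← mul_assoc, ENNReal.inv_mul_cancel h0 ht, one_mul, mul_pow]
    calc _ ≤ ewt d s k * _ := mul_le_mul_right hcs _
      _ ≤ _ := by
        rw [← mul_assoc]
        refine mul_le_mul_left ?_ _
        rw [← ENNReal.tsum_mul_left]
        calc _ ≤ ∑' l, ENNReal.ofReal (4 ^ s) * ((ewt d s l)⁻¹ + (ewt d s (l - k))⁻¹) :=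
              ENNReal.tsum_le_tsum fun l => by
                simpa using ewt_sub_mul_inv_le d hs l (l - k)
          _ = _ := by
            have hshift : ∑' l, (ewt d s (l - k))⁻¹ = S :=
              (Equiv.subRight k).tsum_eq fun l => (ewt d s l)⁻¹
            rw [ENNReal.tsum_mul_left, ENNReal.tsum_add, hshift, two_mul]
  refine (ENNReal.tsum_le_tsum key).trans_eq ?_
  rw [ENNReal.tsum_mul_left, ENNReal.tsum_comm]
  congr 1
  simp only [ENNReal.tsum_mul_left]
  simp only [fun l => (Equiv.subLeft l).tsum_eq fun k => ewt d s k * g k ^ 2,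
    ← Equiv.subLeft_apply, ENNReal.tsum_mul_right, energy]

lemma altConv_succ (d m : ℕ) (F : Fin (m + 1) → (Fin d → ℤ) → ℝ≥0∞) :
    altConv d (m + 1) F = fun k => ∑' l, F 0 l * altConv d m (fun j => F j.succ) (l - k) := by
  funext k
  unfold altConv
  rw [← (Fin.consEquiv fun _ => Fin d → ℤ).tsum_eq, ENNReal.summable.tsum_prod' fun _ => ENNReal.summable]
  refine tsum_congr fun l => ?_
  rw [← ENNReal.tsum_mul_left]
  refine tsum_congr fun κ => ?_
  have hsum : (∑ j : Fin (m + 1), ((-1 : ℤ) ^ (j : ℕ)) •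
      (Fin.cons l κ : Fin (m + 1) → (Fin d → ℤ)) j) =
      l - ∑ j : Fin m, ((-1 : ℤ) ^ (j : ℕ)) • κ j := by
    simp [Fin.sum_univ_succ, pow_succ, sub_eq_add_neg]
  have hiff : (l - ∑ j : Fin m, ((-1 : ℤ) ^ (j : ℕ)) • κ j = k) ↔
      (∑ j : Fin m, ((-1 : ℤ) ^ (j : ℕ)) • κ j = l - k) :=
    ⟨fun h => by rw [← h]; abel, fun h => by rw [h]; abel⟩
  simp only [Fin.consEquiv_apply, hsum, hiff, mul_ite, mul_zero]
  simp [Fin.prod_univ_succ]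

lemma exists_energy_altConv_le (d : ℕ) {s : ℝ} (hs : (d : ℝ) / 2 < s) :
    ∃ K : ℝ≥0∞, K ≠ ⊤ ∧ ∀ m (F : Fin m → (Fin d → ℤ) → ℝ≥0∞),
      energy d s (altConv d m F) ≤ ewt d s 0 * K ^ m * ∏ j, energy d s (F j) := by
  have hs0 : 0 < s := lt_of_le_of_lt (by positivity) hs
  refine ⟨ENNReal.ofReal (4 ^ s) * (2 * ∑' k, (ewt d s k)⁻¹),
    ENNReal.mul_ne_top ENNReal.ofReal_ne_top
      (ENNReal.mul_ne_top (by simp) (tsum_inv_ewt_ne_top d hs)), fun m => ?_⟩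
  induction m with
  | zero =>
    intro F
    have : ∀ k, altConv d 0 F k = if k = 0 then 1 else 0 := fun k => by
      simp [altConv, eq_comm]
    simp only [energy, this]
    rw [tsum_eq_single 0 (by simp +contextual)]
    simp
  | succ m ih =>
    intro F
    rw [altConv_succ, Fin.prod_univ_succ]
    refine (energy_conv_le d hs0 _ _).trans ?_
    refine (mul_le_mul_right (mul_le_mul_right (ih _) _) _).trans_eq ?_
    ring

lemma energy_mono (d : ℕ) (s : ℝ) {f g : (Fin d → ℤ) → ℝ≥0∞} (h : ∀ k, f k ≤ g k) :
    energy d s f ≤ energy d s g :=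
  ENNReal.tsum_le_tsum fun k => by gcongr; exact h k

lemma energy_sum_le (d : ℕ) (s : ℝ) {ι : Type*} [Fintype ι] (f : ι → (Fin d → ℤ) → ℝ≥0∞) :
    energy d s (fun k => ∑ i, f i k) ≤ Fintype.card ι * ∑ i, energy d s (f i) := by
  unfold energy
  rw [← Summable.tsum_finsetSum fun _ _ => ENNReal.summable, ← ENNReal.tsum_mul_left]
  refine ENNReal.tsum_le_tsum fun k => ?_
  rw [← Finset.mul_sum, mul_left_comm]
  exact mul_le_mul_right (ENNReal.sq_sum_le fun i => f i k) _

lemma energy_add_le (d : ℕ) (s : ℝ) (f g : (Fin d → ℤ) → ℝ≥0∞) :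
    energy d s (fun k => f k + g k) ≤ 2 * (energy d s f + energy d s g) := by
  simpa [Fin.sum_univ_two] using energy_sum_le d s ![f, g]

lemma ne_top_of_energy_ne_top {d : ℕ} {s : ℝ} {f : (Fin d → ℤ) → ℝ≥0∞}
    (h : energy d s f ≠ ⊤) (k : Fin d → ℤ) : f k ≠ ⊤ := by
  intro hk
  refine ENNReal.ne_top_of_tsum_ne_top h k ?_
  simp [hk, ENNReal.mul_top (ewt_ne_zero d s k)]

lemma ewt_mul_enorm_sq (d : ℕ) (s : ℝ) (v : (Fin d → ℤ) → ℂ) (k : Fin d → ℤ) :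
    ewt d s k * ‖v k‖ₑ ^ 2 = ENNReal.ofReal (wt d s k * ‖v k‖ ^ 2) := by
  rw [ENNReal.ofReal_mul (zero_le_one.trans (one_le_wt d s k)),
    ENNReal.ofReal_pow (norm_nonneg _), ofReal_norm, ewt]

lemma hnorm_eq_sqrt_energy (d : ℕ) (s : ℝ) (v : (Fin d → ℤ) → ℂ) :
    hnorm d s v = Real.sqrt (energy d s fun k => ‖v k‖ₑ).toReal := by
  unfold hnorm energy
  simp only [ewt_mul_enorm_sq]
  rw [ENNReal.tsum_toReal_eq fun _ => ENNReal.ofReal_ne_top]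
  congr 1
  refine tsum_congr fun k => (ENNReal.toReal_ofReal ?_).symm
  exact mul_nonneg (zero_le_one.trans (one_le_wt d s k)) (by positivity)

lemma memH.energy_ne_top {d : ℕ} {s : ℝ} {v : (Fin d → ℤ) → ℂ} (hv : memH d s v) :
    energy d s (fun k => ‖v k‖ₑ) ≠ ⊤ := by
  unfold energy
  simp only [ewt_mul_enorm_sq]
  exact Summable.tsum_ofReal_ne_top hv

lemma memH.energy_le {d : ℕ} {s M : ℝ} {v : (Fin d → ℤ) → ℂ} (hv : memH d s v)
    (hM : hnorm d s v ≤ M) : energy d s (fun k => ‖v k‖ₑ) ≤ ENNReal.ofReal (M ^ 2) := by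
  rw [hnorm_eq_sqrt_energy, Real.sqrt_le_iff] at hM
  exact (ENNReal.le_ofReal_iff_toReal_le hv.energy_ne_top (sq_nonneg M)).2 hM.2

lemma enorm_prod_sub_prod_le {ι : Type*} [Fintype ι] [DecidableEq ι] (a b : ι → ℂ) :
    ‖∏ i, a i - ∏ i, b i‖ₑ ≤
      ∑ i, ∏ j, if j = i then ‖a j - b j‖ₑ else ‖a j‖ₑ + ‖b j‖ₑ := by
  have h := (MultilinearMap.mkPiAlgebra ℂ ι ℂ).norm_image_sub_le_of_bound' zero_le_one
    (by simp) a b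
  simp only [MultilinearMap.mkPiAlgebra_apply, one_mul] at h
  have h' : ‖∏ i, a i - ∏ i, b i‖ ≤
      ∑ i, ∏ j, if j = i then ‖a j - b j‖ else ‖a j‖ + ‖b j‖ := by
    refine h.trans (Finset.sum_le_sum fun i _ => Finset.prod_le_prod ?_ ?_)
    · intro j _; split_ifs <;> positivity
    · intro j _
      split_ifs with hj
      · rw [hj]
      · exact max_le_add_of_nonneg (norm_nonneg _) (norm_nonneg _)
  have hnn : ∀ i j, 0 ≤ if j = i then ‖a j - b j‖ else ‖a j‖ + ‖b j‖ := fun i j => by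
    split_ifs <;> positivity
  rw [← ofReal_norm]
  refine (ENNReal.ofReal_le_ofReal h').trans_eq ?_
  rw [ENNReal.ofReal_sum_of_nonneg fun i _ => Finset.prod_nonneg fun j _ => hnn i j]
  refine Finset.sum_congr rfl fun i _ => ?_
  rw [ENNReal.ofReal_prod_of_nonneg fun j _ => hnn i j]
  refine Finset.prod_congr rfl fun j _ => ?_
  split_ifs
  · rw [ofReal_norm]
  · rw [ENNReal.ofReal_add (norm_nonneg _) (norm_nonneg _), ofReal_norm, ofReal_norm]

lemma enorm_Pterm (d n : ℕ) (v : (Fin d → ℤ) → ℂ) (k : Fin d → ℤ)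
    (κ : Fin (2 * n + 1) → (Fin d → ℤ)) :
    ‖Pterm d n v k κ‖ₑ = if (∑ j : Fin (2 * n + 1), ((-1 : ℤ) ^ (j : ℕ)) • κ j) = k then
      ∏ j, ‖v (κ j)‖ₑ else 0 := by
  unfold Pterm
  split_ifs
  · simp only [← ofReal_norm, norm_prod]
    rw [ENNReal.ofReal_prod_of_nonneg fun _ _ => norm_nonneg _]
    refine Finset.prod_congr rfl fun j _ => ?_
    split_ifs <;> simp
  · simp

lemma enorm_Pterm_sub_le (d n : ℕ) (v w : (Fin d → ℤ) → ℂ) (k : Fin d → ℤ)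
    (κ : Fin (2 * n + 1) → (Fin d → ℤ)) :
    ‖Pterm d n v k κ - Pterm d n w k κ‖ₑ ≤
      ∑ i, if (∑ j : Fin (2 * n + 1), ((-1 : ℤ) ^ (j : ℕ)) • κ j) = k then
        ∏ j, (if j = i then fun l => ‖v l - w l‖ₑ else fun l => ‖v l‖ₑ + ‖w l‖ₑ) (κ j) else 0 := by
  unfold Pterm
  split_ifs
  · refine (enorm_prod_sub_prod_le _ _).trans_eq ?_
    refine Finset.sum_congr rfl fun i _ => Finset.prod_congr rfl fun j _ => ?_
    simp only [← ofReal_norm]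
    split_ifs <;> simp [← map_sub]
  · simp

lemma summable_Pterm {d n : ℕ} {s : ℝ} (hs : (d : ℝ) / 2 < s) {v : (Fin d → ℤ) → ℂ}
    (hv : memH d s v) (k : Fin d → ℤ) : Summable (Pterm d n v k) := by
  obtain ⟨K, hK, hbound⟩ := exists_energy_altConv_le d hs
  have htop : energy d s (altConv d (2 * n + 1) fun _ l => ‖v l‖ₑ) ≠ ⊤ := by
    refine ne_top_of_le_ne_top ?_ (hbound _ _)
    simp only [Finset.prod_const]
    exact ENNReal.mul_ne_top (ENNReal.mul_ne_top (ewt_ne_top d s _) (ENNReal.pow_ne_top hK))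
      (ENNReal.pow_ne_top hv.energy_ne_top)
  have hk := ne_top_of_energy_ne_top htop k
  refine Summable.of_enorm ?_
  simpa only [enorm_Pterm, altConv] using hk

lemma enorm_Pk_sub_le {d n : ℕ} {s : ℝ} (hs : (d : ℝ) / 2 < s) {v w : (Fin d → ℤ) → ℂ}
    (hv : memH d s v) (hw : memH d s w) (k : Fin d → ℤ) :
    ‖Pk d n v k - Pk d n w k‖ₑ ≤ ∑ i, altConv d (2 * n + 1)
      (fun j => if j = i then fun l => ‖v l - w l‖ₑ else fun l => ‖v l‖ₑ + ‖w l‖ₑ) k := by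
  unfold Pk altConv
  rw [← (summable_Pterm hs hv k).tsum_sub (summable_Pterm hs hw k),
    ← Summable.tsum_finsetSum fun _ _ => ENNReal.summable]
  exact enorm_tsum_le_tsum_enorm.trans
    (ENNReal.tsum_le_tsum fun κ => enorm_Pterm_sub_le d n v w k κ)

lemma exists_energy_Pk_sub_le (d n : ℕ) {s : ℝ} (hs : (d : ℝ) / 2 < s) :
    ∃ A : ℝ≥0∞, A ≠ ⊤ ∧ ∀ v w : (Fin d → ℤ) → ℂ, memH d s v → memH d s w →
      energy d s (fun k => ‖Pk d n v k - Pk d n w k‖ₑ) ≤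
        A * energy d s (fun k => ‖v k‖ₑ + ‖w k‖ₑ) ^ (2 * n) *
          energy d s (fun k => ‖v k - w k‖ₑ) := by
  obtain ⟨K, hK, hbound⟩ := exists_energy_altConv_le d hs
  refine ⟨(2 * n + 1 : ℕ) * ((2 * n + 1 : ℕ) * (ewt d s 0 * K ^ (2 * n + 1))),
    ENNReal.mul_ne_top (ENNReal.natCast_ne_top _) (ENNReal.mul_ne_top (ENNReal.natCast_ne_top _)
      (ENNReal.mul_ne_top (ewt_ne_top d s _) (ENNReal.pow_ne_top hK))), fun v w hv hw => ?_⟩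
  refine (energy_mono d s (enorm_Pk_sub_le hs hv hw)).trans ((energy_sum_le d s _).trans ?_)
  refine (mul_le_mul_right (Finset.sum_le_sum fun i _ => hbound _ _) _).trans_eq ?_
  simp only [apply_ite (energy d s), Finset.prod_ite, Finset.filter_eq', Finset.filter_ne',
    Finset.mem_univ, if_true, Finset.prod_const, Finset.card_singleton, Finset.card_erase_of_mem,
    Finset.card_univ, Fintype.card_fin, Finset.sum_const, nsmul_eq_mul, pow_one,
    Nat.add_sub_cancel]
  ring

/-- For `d ≥ 1`, `s > d/2`, `n ≥ 1` and `M > 0` there is `C = C(d,s,n,M)`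
such that for all `v, w ∈ h^s` with `|v|_s ≤ M`, `|w|_s ≤ M` one has
`|P(v,n) − P(w,n)|_s ≤ C |v − w|_s`. -/
theorem P_locally_lipschitz (d n : ℕ) (hd : 1 ≤ d) (hn : 1 ≤ n) (s : ℝ)
    (hs : (d : ℝ) / 2 < s) (M : ℝ) (hM : 0 < M) :
    ∃ C : ℝ, 0 < C ∧ ∀ v w : (Fin d → ℤ) → ℂ, memH d s v → memH d s w →
      hnorm d s v ≤ M → hnorm d s w ≤ M →
      hnorm d s (fun k => Pk d n v k - Pk d n w k)
        ≤ C * hnorm d s (fun k => v k - w k) := by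
  obtain ⟨A, hA, hbound⟩ := exists_energy_Pk_sub_le d n hs
  set G : ℝ≥0∞ := 2 * (ENNReal.ofReal (M ^ 2) + ENNReal.ofReal (M ^ 2))
  have hG : G ≠ ⊤ := ENNReal.mul_ne_top (by simp) (by simp)
  have hAG : A * G ^ (2 * n) ≠ ⊤ := ENNReal.mul_ne_top hA (ENNReal.pow_ne_top hG)
  refine ⟨Real.sqrt (A * G ^ (2 * n)).toReal + 1, by positivity, fun v w hv hw hvM hwM => ?_⟩
  have hsum : energy d s (fun k => ‖v k‖ₑ + ‖w k‖ₑ) ≤ G :=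
    (energy_add_le d s _ _).trans
      (mul_le_mul_right (add_le_add (hv.energy_le hvM) (hw.energy_le hwM)) _)
  have hdiff : energy d s (fun k => ‖v k - w k‖ₑ) ≠ ⊤ :=
    ne_top_of_le_ne_top hG ((energy_mono d s fun k => enorm_sub_le).trans hsum)
  have hP : energy d s (fun k => ‖Pk d n v k - Pk d n w k‖ₑ) ≤
      A * G ^ (2 * n) * energy d s (fun k => ‖v k - w k‖ₑ) :=
    (hbound v w hv hw).trans (by gcongr)
  have hreal := ENNReal.toReal_mono (ENNReal.mul_ne_top hAG hdiff) hP
  rw [ENNReal.toReal_mul] at hreal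
  rw [hnorm_eq_sqrt_energy, hnorm_eq_sqrt_energy]
  calc _ ≤ Real.sqrt (A * G ^ (2 * n)).toReal * Real.sqrt _ := by
        rw [← Real.sqrt_mul ENNReal.toReal_nonneg]
        exact Real.sqrt_le_sqrt hreal
    _ ≤ _ := by gcongr; linarith
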